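/- Let $R$ be a valuation ring, let $F$ be a flat pure-injective $R$-module, and let $U$ be a uniserial $R$-module (its submodules are totally ordered by inclusion). Then $F \otimes_R U$ is a pure-injective $R$-module. -/

import Mathlib

open TensorProduct

universe u v

/-- A linear map is *pure* if it stays injective after tensoring with any module. -/
def LinearMap.IsPure {R : Type u} [CommRing R] {N P : Type v} [AddCommGroup N] [Module R N]
    [AddCommGroup P] [Module R P] (f : N →ₗ[R] P) : Prop :=
  ∀ (L : Type v) [AddCommGroup L] [Module R L], Function.Injective (LinearMap.rTensor L f)

/-- A module `M` is *pure-injective* if every linear map to `M` extends along any pure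
injection; this is equivalent to the exactness of `0 → Hom(L,M) → Hom(P,M) → Hom(N,M) → 0`
for every pure exact sequence `0 → N → P → L → 0`. -/
def IsPureInjective (R : Type u) (M : Type v) [CommRing R] [AddCommGroup M]
    [Module R M] : Prop :=
  ∀ ⦃N P : Type max u v⦄ [AddCommGroup N] [Module R N] [AddCommGroup P] [Module R P]
    (f : N →ₗ[R] P), Function.Injective f → f.IsPure →
    ∀ g : N →ₗ[R] M, ∃ h : P →ₗ[R] M, h.comp f = g

universe w z

section PureInjective

/-- A pure linear map reflects divisibility by scalars. -/
theorem LinearMap.IsPure.exists_eq_smul {R : Type u} [CommRing R] {N P : Type max u v}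
    [AddCommGroup N] [Module R N] [AddCommGroup P] [Module R P] {f : N →ₗ[R] P}
    (hf : f.IsPure) {s : R} {n : N} {p : P} (h : f n = s • p) : ∃ n', n = s • n' := by
  let I : Ideal R := Ideal.span {s}
  let q : ULift.{max u v} (R ⧸ I) := ULift.up 1
  have hq : s • q = 0 := by
    apply ULift.ext
    change s • (1 : R ⧸ I) = 0
    rw [← map_one (Ideal.Quotient.mk I), Algebra.smul_def, Ideal.Quotient.algebraMap_eq,
      ← map_mul, mul_one]
    exact Ideal.Quotient.eq_zero_iff_mem.2 (Ideal.mem_span_singleton_self s)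
  have h0 : n ⊗ₜ[R] q = 0 := by
    apply hf (ULift.{max u v} (R ⧸ I))
    rw [LinearMap.rTensor_tmul, map_zero, h, TensorProduct.smul_tmul, hq, TensorProduct.tmul_zero]
  let e := (LinearEquiv.lTensor N (ULift.moduleEquiv (R := R) (M := R ⧸ I))).trans
    (TensorProduct.tensorQuotEquivQuotSMul N I)
  have h1 : Submodule.Quotient.mk (p := I • (⊤ : Submodule R N)) n = 0 := by
    have := congrArg e h0
    rw [map_zero] at this
    rw [← this]
    change _ = TensorProduct.tensorQuotEquivQuotSMul N I (n ⊗ₜ Ideal.Quotient.mk I 1)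
    rw [TensorProduct.tensorQuotEquivQuotSMul_tmul_mk, one_smul]
  rw [Submodule.Quotient.mk_eq_zero, Submodule.ideal_span_singleton_smul,
    Submodule.mem_smul_pointwise_iff_exists] at h1
  obtain ⟨n', -, hn⟩ := h1
  exact ⟨n', hn.symm⟩

variable {R : Type u} [CommRing R]

/-- The families that vanish eventually along a filter. -/
def eventuallyZero (R : Type u) [CommRing R] (F : Type v) [AddCommGroup F] [Module R F]
    {I : Type w} (l : Filter I) : Submodule R (I → F) where
  carrier := {z | ∀ᶠ j in l, z j = 0}
  zero_mem' := Filter.Eventually.of_forall fun _ => rfl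
  add_mem' {a b} ha hb := by
    filter_upwards [ha, hb] with j h1 h2
    rw [Pi.add_apply, h1, h2, add_zero]
  smul_mem' r a ha := by
    filter_upwards [ha] with j h
    rw [Pi.smul_apply, h, smul_zero]

/-- The diagonal map of a module into a reduced power. -/
def diagReducedPower (R : Type u) [CommRing R] (F : Type v) [AddCommGroup F] [Module R F]
    {I : Type w} (l : Filter I) : F →ₗ[R] (I → F) ⧸ eventuallyZero R F l :=
  (eventuallyZero R F l).mkQ ∘ₗ LinearMap.pi fun _ => LinearMap.id

theorem diagReducedPower_rTensor_injective {F : Type v} [AddCommGroup F] [Module R F]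
    {I : Type w} (l : Filter I) [l.NeBot] (L : Type z) [AddCommGroup L] [Module R L] :
    Function.Injective ((diagReducedPower R F l).rTensor L) := by
  let Z := eventuallyZero R F l
  rw [injective_iff_map_eq_zero]
  intro t ht
  rw [diagReducedPower, LinearMap.rTensor_comp_apply] at ht
  have hex : Function.Exact Z.subtype Z.mkQ := LinearMap.exact_subtype_mkQ Z
  obtain ⟨z, hz⟩ := (rTensor_exact L hex Z.mkQ_surjective _).1 ht
  have hev : ∀ z : Z ⊗[R] L, ∀ᶠ j in l,
      (LinearMap.proj (R := R) (φ := fun _ : I => F) j).rTensor L (Z.subtype.rTensor L z) = 0 := by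
    intro z
    induction z with
    | zero => simp
    | tmul a b =>
      filter_upwards [a.2] with j hj
      simp only [LinearMap.rTensor_tmul, Submodule.subtype_apply, LinearMap.proj_apply]
      rw [hj, TensorProduct.zero_tmul]
    | add x y hx hy =>
      filter_upwards [hx, hy] with j h1 h2
      rw [map_add, map_add, h1, h2, add_zero]
  obtain ⟨j, hj⟩ := (hev z).exists
  rw [hz, ← LinearMap.rTensor_comp_apply] at hj
  have hid : (LinearMap.proj (R := R) (φ := fun _ : I => F) j) ∘ₗ
      (LinearMap.pi fun _ => LinearMap.id) = LinearMap.id := rfl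
  rwa [hid, LinearMap.rTensor_id_apply] at hj

/-- In a pure-injective module a family has a limit along any proper filter, as far as the
congruences modulo multiples of scalars are concerned. -/
theorem IsPureInjective.exists_limit {F : Type v} [AddCommGroup F] [Module R F]
    (hF : IsPureInjective R F) {I : Type max u v} (l : Filter I) [l.NeBot] (f : I → F) :
    ∃ b : F, ∀ (x : F) (s : R), (∀ᶠ j in l, ∃ y, f j - x = s • y) → ∃ y, b - x = s • y := by
  let e : ULift.{max u v} F ≃ₗ[R] F := ULift.moduleEquiv
  let d := diagReducedPower R F l ∘ₗ e.toLinearMap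
  have hpure (L : Type max u v) [AddCommGroup L] [Module R L] :
      Function.Injective (d.rTensor L) := by
    rw [LinearMap.rTensor_comp, LinearMap.coe_comp]
    exact (diagReducedPower_rTensor_injective l L).comp (LinearEquiv.rTensor L e).injective
  have hinj : Function.Injective d := by
    have hd : Function.Injective (diagReducedPower R F l) := by
      rw [injective_iff_map_eq_zero]
      intro x hx
      obtain ⟨j, hj⟩ := Filter.Eventually.exists ((Submodule.Quotient.mk_eq_zero _).1 hx)
      exact hj
    exact hd.comp e.injective
  obtain ⟨h, hh⟩ := hF d hinj hpure e.toLinearMap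
  have hdiag (x : F) : h (diagReducedPower R F l x) = x := LinearMap.congr_fun hh (ULift.up x)
  refine ⟨h ((eventuallyZero R F l).mkQ f), fun x s hx => ?_⟩
  obtain ⟨y, hy⟩ := Filter.Eventually.choice hx
  refine ⟨h ((eventuallyZero R F l).mkQ y), ?_⟩
  rw [← map_smul, ← map_smul]
  rw [← hdiag x, ← map_sub, diagReducedPower, LinearMap.comp_apply, ← map_sub]
  congr 1
  refine (Submodule.Quotient.eq _).2 ?_
  filter_upwards [hy] with j hj
  exact sub_eq_zero.2 hj

end PureInjective

section Flat

variable {R : Type u} [CommRing R] (F : Type v) [AddCommGroup F] [Module R F]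
  {U : Type w} [AddCommGroup U] [Module R U]

/-- The image of `F ⊗ V` in `F ⊗ U`, for a submodule `V` of `U`. -/
def Submodule.tensorRange (V : Submodule R U) : Submodule R (F ⊗[R] U) :=
  LinearMap.range (V.subtype.lTensor F)

variable {F}

theorem Submodule.tmul_mem_tensorRange {V : Submodule R U} (x : F) {v : U} (hv : v ∈ V) :
    x ⊗ₜ[R] v ∈ V.tensorRange F :=
  ⟨x ⊗ₜ ⟨v, hv⟩, by simp⟩

theorem Submodule.tensorRange_le {V : Submodule R U} {W : Submodule R (F ⊗[R] U)}
    (h : ∀ (x : F), ∀ v ∈ V, x ⊗ₜ[R] v ∈ W) : V.tensorRange F ≤ W := by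
  rintro _ ⟨t, rfl⟩
  induction t with
  | zero => simp
  | tmul a b => simpa using h a b b.2
  | add x y hx hy => rw [map_add]; exact W.add_mem hx hy

theorem Submodule.tensorRange_mono {V W : Submodule R U} (h : V ≤ W) :
    V.tensorRange F ≤ W.tensorRange F :=
  Submodule.tensorRange_le fun x _ hv => Submodule.tmul_mem_tensorRange x (h hv)

theorem Submodule.exists_tmul_of_mem_tensorRange_span_singleton {u : U} {t : F ⊗[R] U}
    (ht : t ∈ (Submodule.span R {u}).tensorRange F) : ∃ x : F, t = x ⊗ₜ u := by
  have h : (Submodule.span R {u}).tensorRange F ≤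
      LinearMap.range ((TensorProduct.mk R F U).flip u) := by
    refine Submodule.tensorRange_le fun x v hv => ?_
    obtain ⟨r, rfl⟩ := Submodule.mem_span_singleton.1 hv
    exact ⟨r • x, by simp⟩
  obtain ⟨x, rfl⟩ := h ht
  exact ⟨x, rfl⟩

/-- The submodule of those `v` for which `r • v` is a multiple of `s`. -/
def Submodule.smulColon (U : Type w) [AddCommGroup U] [Module R U] (r s : R) : Submodule R U :=
  (LinearMap.range (LinearMap.lsmul R U s)).comap (LinearMap.lsmul R U r)

theorem mem_tensorRange_smulColon_iff [Module.Flat R F] {r s : R} {t : F ⊗[R] U} :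
    t ∈ (Submodule.smulColon U r s).tensorRange F ↔ ∃ z, r • t = s • z := by
  constructor
  · intro ht
    have h : (Submodule.smulColon U r s).tensorRange F ≤ Submodule.smulColon (F ⊗[R] U) r s := by
      refine Submodule.tensorRange_le fun x v hv => ?_
      obtain ⟨v', hv'⟩ := hv
      refine ⟨x ⊗ₜ v', ?_⟩
      simp only [LinearMap.lsmul_apply] at hv' ⊢
      rw [← TensorProduct.tmul_smul, hv', TensorProduct.tmul_smul]
    obtain ⟨z, hz⟩ := h ht
    exact ⟨z, hz.symm⟩
  · rintro ⟨z, hz⟩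
    let Q := LinearMap.range (LinearMap.lsmul R U s)
    let φ : U →ₗ[R] U ⧸ Q := Q.mkQ ∘ₗ LinearMap.lsmul R U r
    have hex : Function.Exact (Submodule.smulColon U r s).subtype φ := by
      intro x
      rw [Submodule.coe_subtype, Subtype.range_coe]
      exact Submodule.Quotient.mk_eq_zero _
    refine (Module.Flat.lTensor_exact F hex t).1 ?_
    have hr : (LinearMap.lsmul R U r).lTensor F t = (LinearMap.lsmul R U s).lTensor F z := by
      have key (a : R) : (LinearMap.lsmul R U a).lTensor F = LinearMap.lsmul R (F ⊗[R] U) a :=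
        TensorProduct.ext' fun x y => by simp
      rw [key, key]
      exact hz
    rw [LinearMap.lTensor_comp_apply, hr, ← LinearMap.lTensor_comp_apply]
    have h0 : Q.mkQ ∘ₗ LinearMap.lsmul R U s = 0 := by
      ext x
      exact (Submodule.Quotient.mk_eq_zero _).2 ⟨x, rfl⟩
    rw [h0, LinearMap.lTensor_zero, LinearMap.zero_apply]

theorem exists_eq_smul_of_tmul_eq_zero [Module.Flat R F] {x : F} {u : U} (h : x ⊗ₜ[R] u = 0)
    {s : R} (hs : ∀ a : R, a • u = 0 → s ∣ a) : ∃ y, x = s • y := by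
  let φ := LinearMap.toSpanSingleton R U u
  have hex : Function.Exact (LinearMap.ker φ).subtype φ := LinearMap.exact_subtype_ker_map φ
  have h1 : φ.lTensor F (x ⊗ₜ 1) = 0 := by simpa [φ] using h
  have hker : x ⊗ₜ[R] (1 : R) ∈ (LinearMap.ker φ).tensorRange F :=
    (Module.Flat.lTensor_exact F hex _).1 h1
  have hle : (LinearMap.ker φ).tensorRange F ≤
      (LinearMap.range (LinearMap.lsmul R F s)).comap (TensorProduct.rid R F).toLinearMap := by
    refine Submodule.tensorRange_le fun y a ha => ?_
    obtain ⟨c, rfl⟩ := hs a ha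
    exact ⟨c • y, by simp [mul_smul, smul_comm c s y]⟩
  obtain ⟨y, hy⟩ := hle hker
  exact ⟨y, by simpa using hy.symm⟩

end Flat

section Uniserial

variable {R : Type u} [CommRing R]

/-- Compactness of `F ⊗ U` for cosets of the submodules `F ⊗ V`. -/
theorem exists_mem_cosets_tensorRange (hchain : ∀ a b : R, ∃ c : R, a * c = b ∨ b * c = a)
    {F : Type v} [AddCommGroup F] [Module R F] [Module.Flat R F] (hF : IsPureInjective R F)
    {U : Type v} [AddCommGroup U] [Module R U] (hU : ∀ V W : Submodule R U, V ≤ W ∨ W ≤ V)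
    (C : Set ((F ⊗[R] U) × Submodule R U))
    (hC : ∀ c ∈ C, ∀ d ∈ C, c.1 - d.1 ∈ (c.2 ⊔ d.2).tensorRange F) :
    ∃ b, ∀ c ∈ C, b - c.1 ∈ c.2.tensorRange F := by
  have hC' : ∀ c ∈ C, ∀ d ∈ C, c.2 ≤ d.2 → c.1 - d.1 ∈ d.2.tensorRange F := by
    intro c hc d hd h
    have := hC c hc d hd
    rwa [sup_eq_right.2 h] at this
  by_cases hmin : ∃ c₀ ∈ C, ∀ c ∈ C, c₀.2 ≤ c.2
  · obtain ⟨c₀, h₀, hle⟩ := hmin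
    exact ⟨c₀.1, fun c hc => hC' c₀ h₀ c hc (hle c hc)⟩
  push Not at hmin
  rcases C.eq_empty_or_nonempty with rfl | ⟨c₀, h₀⟩
  · exact ⟨0, by simp⟩
  have hlt : ∀ c ∈ C, ∃ d ∈ C, d.2 ≤ c.2 ∧ ∃ v ∈ c.2, v ∉ d.2 := by
    intro c hc
    obtain ⟨d, hd, hcd⟩ := hmin c hc
    exact ⟨d, hd, (hU _ _).resolve_left hcd, SetLike.not_le_iff_exists.1 hcd⟩
  have hspan : ∀ (V : Submodule R U) (v : U), v ∉ V → V ≤ Submodule.span R {v} := fun V v hv =>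
    (hU _ _).resolve_right fun h => hv (h (Submodule.mem_span_singleton_self v))
  obtain ⟨c₁, h₁, -, u, -, hu⟩ := hlt c₀ h₀
  let I := ULift.{u} {c // c ∈ C ∧ c.2 ≤ c₁.2}
  have hrep : ∀ c : I, ∃ x : F, c.down.1.1 - c₁.1 = x ⊗ₜ u := fun c =>
    Submodule.exists_tmul_of_mem_tensorRange_span_singleton
      (Submodule.tensorRange_mono (hspan _ u hu) (hC' _ c.down.2.1 _ h₁ c.down.2.2))
  choose f hf using hrep
  let _ : Preorder I := Preorder.lift fun c => c.down.1.2
  have : Nonempty I := ⟨⟨⟨c₁, h₁, le_rfl⟩⟩⟩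
  have : IsCodirectedOrder I := ⟨fun a b => by
    rcases hU a.down.1.2 b.down.1.2 with h | h
    · exact ⟨a, le_refl a, h⟩
    · exact ⟨b, h, le_refl b⟩⟩
  obtain ⟨b, hb⟩ := hF.exists_limit (Filter.atBot : Filter I) f
  have hsmall : ∀ c ∈ C, c.2 ≤ c₁.2 → b ⊗ₜ u + c₁.1 - c.1 ∈ c.2.tensorRange F := by
    intro c hc hc₁
    obtain ⟨d, hd, hdc, v, hvc, hvd⟩ := hlt c hc
    obtain ⟨s, rfl⟩ := Submodule.mem_span_singleton.1 (hspan _ u hu (hc₁ hvc))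
    let d' : I := ⟨⟨d, hd, hdc.trans hc₁⟩⟩
    have hs : ∀ a : R, a • u = 0 → s ∣ a := by
      intro a ha
      obtain ⟨e, he | he⟩ := hchain s a
      · exact ⟨e, he.symm⟩
      · refine absurd ?_ hvd
        rw [← he, mul_comm, mul_smul, ha, smul_zero]
        exact d.2.zero_mem
    have hev : ∀ᶠ j in (Filter.atBot : Filter I), ∃ y, f j - f d' = s • y := by
      filter_upwards [Filter.eventually_le_atBot d'] with j hj
      have hjd := hC' _ j.down.2.1 d hd hj
      obtain ⟨x, hx⟩ := Submodule.exists_tmul_of_mem_tensorRange_span_singleton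
        (Submodule.tensorRange_mono (hspan _ _ hvd) hjd)
      have hzero : (f j - f d' - s • x) ⊗ₜ[R] u = 0 := by
        rw [TensorProduct.sub_tmul, TensorProduct.sub_tmul, ← hf, ← hf, TensorProduct.smul_tmul,
          ← hx]
        change j.down.1.1 - c₁.1 - (d.1 - c₁.1) - (j.down.1.1 - d.1) = 0
        abel
      obtain ⟨y, hy⟩ := exists_eq_smul_of_tmul_eq_zero hzero hs
      exact ⟨y + x, by rw [smul_add, ← hy]; abel⟩
    obtain ⟨y, hy⟩ := hb _ s hev
    have hsplit : b ⊗ₜ u + c₁.1 - c.1 = y ⊗ₜ (s • u) + (d.1 - c.1) := by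
      rw [← TensorProduct.smul_tmul, ← hy, TensorProduct.sub_tmul, ← hf]
      change _ = b ⊗ₜ u - (d.1 - c₁.1) + (d.1 - c.1)
      abel
    rw [hsplit]
    exact add_mem (Submodule.tmul_mem_tensorRange y hvc) (hC' d hd c hc hdc)
  refine ⟨b ⊗ₜ u + c₁.1, fun c hc => ?_⟩
  rcases hU c.2 c₁.2 with h | h
  · exact hsmall c hc h
  · have := add_mem (Submodule.tensorRange_mono h (hsmall c₁ h₁ le_rfl)) (hC' c₁ h₁ c hc h)
    rwa [sub_add_sub_cancel] at this

end Uniserial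

section DivisibilityPreserving

variable {R : Type u} [CommRing R] {P : Type v} [AddCommGroup P] [Module R P]
  {M : Type w} [AddCommGroup M] [Module R M]

/-- A linear relation preserves divisibility by scalars; taking the scalar `0`, it is the graph
of a partial linear map. -/
def PreservesDivisibility (G : Submodule R (P × M)) : Prop :=
  ∀ x ∈ G, ∀ (s : R) (p : P), x.1 = s • p → ∃ z, x.2 = s • z

namespace PreservesDivisibility

variable {G : Submodule R (P × M)}

theorem exists_add_smul_eq (hchain : ∀ a b : R, ∃ c : R, a * c = b ∨ b * c = a)
    (hG : PreservesDivisibility G) {p : P} {x : P × M} (hx : x ∈ G) {r s : R} {y : P}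
    (h : x.1 + r • p = s • y) : ∃ b z, x.2 + r • b = s • z := by
  obtain ⟨t, rfl | rfl⟩ := hchain s r
  · obtain ⟨z, hz⟩ := hG x hx s (y - t • p) (by linear_combination (norm := module) h)
    exact ⟨0, z, by simp [hz]⟩
  · obtain ⟨z, hz⟩ := hG x hx r (t • y - p) (by linear_combination (norm := module) h)
    exact ⟨-z, 0, by simp [hz]⟩

theorem exists_pair_of_dvd (hchain : ∀ a b : R, ∃ c : R, a * c = b ∨ b * c = a)
    (hG : PreservesDivisibility G) {p : P} {x x' : P × M} (hx : x ∈ G) (hx' : x' ∈ G)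
    {r s c s' : R} {y y' : P} (h : x.1 + r • p = s • y) (h' : x'.1 + (r * c) • p = s' • y') :
    ∃ b z z', x.2 + r • b = s • z ∧ x'.2 + (r * c) • b = s' • z' := by
  have hdiff : x' - c • x ∈ G := G.sub_mem hx' (G.smul_mem c hx)
  obtain ⟨t, rfl | rfl⟩ := hchain s r
  · obtain ⟨z, hz⟩ := hG x hx s (y - t • p) (by linear_combination (norm := module) h)
    obtain ⟨b, z', hb⟩ := hG.exists_add_smul_eq hchain hx' h'
    exact ⟨b, z + t • b, z', by rw [hz]; module, hb⟩
  obtain ⟨b, z, hb⟩ := hG.exists_add_smul_eq hchain hx h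
  obtain ⟨t', ht' | rfl⟩ := hchain s' (r * c)
  · rw [← ht'] at h' ⊢
    obtain ⟨z', hz'⟩ := hG x' hx' s' (y' - t' • p) (by linear_combination (norm := module) h')
    exact ⟨b, z, z' + t' • b, hb, by rw [hz']; module⟩
  obtain ⟨d, rfl | rfl⟩ := hchain t t'
  · obtain ⟨w, hw⟩ := hG _ hdiff (r * c * t) (d • y' - y) (by
      simp only [Prod.fst_sub, Prod.smul_fst]
      linear_combination (norm := module) h' - c • h)
    simp only [Prod.snd_sub, Prod.smul_snd] at hw
    refine ⟨b - t • (w + z), -w, 0, ?_, ?_⟩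
    · linear_combination (norm := module) hb
    · linear_combination (norm := module) hw + c • hb
  · obtain ⟨w, hw⟩ := hG _ hdiff (r * c * t') (y' - d • y) (by
      simp only [Prod.fst_sub, Prod.smul_fst]
      linear_combination (norm := module) h' - c • h)
    simp only [Prod.snd_sub, Prod.smul_snd] at hw
    exact ⟨b, z, w + d • z, hb, by linear_combination (norm := module) hw + c • hb⟩

theorem exists_pair (hchain : ∀ a b : R, ∃ c : R, a * c = b ∨ b * c = a)
    (hG : PreservesDivisibility G) {p : P} {x x' : P × M} (hx : x ∈ G) (hx' : x' ∈ G)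
    {r s r' s' : R} {y y' : P} (h : x.1 + r • p = s • y) (h' : x'.1 + r' • p = s' • y') :
    ∃ b z z', x.2 + r • b = s • z ∧ x'.2 + r' • b = s' • z' := by
  obtain ⟨c, rfl | rfl⟩ := hchain r r'
  · exact hG.exists_pair_of_dvd hchain hx hx' h h'
  · obtain ⟨b, z, z', hz, hz'⟩ := hG.exists_pair_of_dvd hchain hx' hx h' h
    exact ⟨b, z', z, hz', hz⟩

theorem eq_zero (hG : PreservesDivisibility G) {y : M} (h : ((0 : P), y) ∈ G) : y = 0 := by
  obtain ⟨z, hz⟩ := hG _ h 0 0 (by simp)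
  simpa using hz

/-- A divisibility-preserving relation defined everywhere is the graph of a linear map. -/
theorem exists_linearMap (hG : PreservesDivisibility G) (htotal : ∀ p, ∃ b, (p, b) ∈ G) :
    ∃ h : P →ₗ[R] M, ∀ x ∈ G, h x.1 = x.2 := by
  choose φ hφ using htotal
  have huniq : ∀ x ∈ G, φ x.1 = x.2 := fun ⟨a, _⟩ hx =>
    sub_eq_zero.1 (hG.eq_zero (by simpa using G.sub_mem (hφ a) hx))
  exact ⟨{ toFun := φ
           map_add' := fun a b => huniq _ (G.add_mem (hφ a) (hφ b))
           map_smul' := fun r a => huniq _ (G.smul_mem r (hφ a)) }, huniq⟩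

/-- A divisibility-preserving relation is contained in a maximal one. -/
theorem exists_le_maximal (hG : PreservesDivisibility G) :
    ∃ G', G ≤ G' ∧ Maximal PreservesDivisibility G' := by
  refine zorn_le_nonempty₀ {G : Submodule R (P × M) | PreservesDivisibility G}
    (fun c hc hchain G₀ h₀ => ⟨sSup c, ?_, fun _ h => le_sSup h⟩) G hG
  intro x hx s p hp
  obtain ⟨H, hH, hxH⟩ := (Submodule.mem_sSup_of_directed ⟨G₀, h₀⟩ hchain.directedOn).1 hx
  exact hc hH x hxH s p hp

theorem sup_span_singleton (p : P) (b : M)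
    (hb : ∀ x ∈ G, ∀ (r s : R) (y : P), x.1 + r • p = s • y → ∃ z, x.2 + r • b = s • z) :
    PreservesDivisibility (G ⊔ Submodule.span R {(p, b)}) := by
  intro x hx s q hq
  obtain ⟨g, hg, w, hw, rfl⟩ := Submodule.mem_sup.1 hx
  obtain ⟨r, rfl⟩ := Submodule.mem_span_singleton.1 hw
  exact hb g hg r s q hq

end PreservesDivisibility

end DivisibilityPreserving

/-- Let `R` be a valuation ring, `F` a flat pure-injective `R`-module and
`U` a uniserial `R`-module (its submodules are totally ordered by inclusion).  Then
`F ⊗[R] U` is a pure-injective `R`-module. -/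
theorem pureInjective_tensor_uniserial {R : Type u} [CommRing R]
    (hchain : ∀ a b : R, ∃ c : R, a * c = b ∨ b * c = a)
    {F : Type v} [AddCommGroup F] [Module R F] (hflat : Module.Flat R F)
    (hF : IsPureInjective R F)
    {U : Type v} [AddCommGroup U] [Module R U]
    (hU : ∀ V W : Submodule R U, V ≤ W ∨ W ≤ V) :
    IsPureInjective R (F ⊗[R] U) := by
  intro N P _ _ _ _ f _ hpure g
  have h₀ : PreservesDivisibility (LinearMap.range (f.prod g)) := by
    rintro _ ⟨n, rfl⟩ s p hp
    obtain ⟨n', rfl⟩ := LinearMap.IsPure.exists_eq_smul.{u, v} hpure hp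
    exact ⟨g n', by simp⟩
  obtain ⟨G, hle, hmax⟩ := h₀.exists_le_maximal
  have hG : PreservesDivisibility G := hmax.prop
  have htotal : ∀ p, ∃ b, (p, b) ∈ G := by
    intro p
    let C : Set ((F ⊗[R] U) × Submodule R U) := {c | ∃ x ∈ G, ∃ (r s : R) (y : P),
      x.1 + r • p = s • y ∧ (∃ z, x.2 + r • c.1 = s • z) ∧ c.2 = Submodule.smulColon U r s}
    obtain ⟨b, hb⟩ := exists_mem_cosets_tensorRange hchain hF hU C (by
      rintro ⟨c, _⟩ ⟨x, hx, r, s, y, hy, ⟨z, hz⟩, rfl⟩ ⟨d, _⟩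
        ⟨x', hx', r', s', y', hy', ⟨z', hz'⟩, rfl⟩
      obtain ⟨b, t, t', ht, ht'⟩ := hG.exists_pair hchain hx hx' hy hy'
      rw [← sub_add_sub_cancel c b d]
      refine add_mem (Submodule.tensorRange_mono le_sup_left
        (mem_tensorRange_smulColon_iff.2 ⟨z - t, ?_⟩)) (Submodule.tensorRange_mono le_sup_right
        (mem_tensorRange_smulColon_iff.2 ⟨t' - z', ?_⟩))
      · linear_combination (norm := module) hz - ht
      · linear_combination (norm := module) ht' - hz')
    have hmem := hmax.le_of_ge (PreservesDivisibility.sup_span_singleton p b (by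
      intro x hx r s y hy
      obtain ⟨c, z, hz⟩ := hG.exists_add_smul_eq hchain hx hy
      obtain ⟨t, ht⟩ := mem_tensorRange_smulColon_iff.1
        (hb (c, Submodule.smulColon U r s) ⟨x, hx, r, s, y, hy, ⟨z, hz⟩, rfl⟩)
      exact ⟨z + t, by linear_combination (norm := module) hz + ht⟩)) le_sup_left
    exact ⟨b, hmem (Submodule.mem_sup_right (Submodule.mem_span_singleton_self _))⟩
  obtain ⟨h, hh⟩ := hG.exists_linearMap htotal
  exact ⟨h, LinearMap.ext fun n => hh _ (hle ⟨n, rfl⟩)⟩
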